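/- arXiv:1507.08082 — 4 statements merged into one kernel-verified Lean document; each statement's English description precedes it below -/
import Mathlib

section
/- Let G = (N, L) be a finite strongly connected directed graph, let M ⊆ L be the set of measured links and U = L \ M the unmeasured links. Then a link e ∈ U is identifiable from M (i.e., any two nonnegative flows agreeing on every link of M agree on e) if and only if e does not belong to any undirected cycle consisting entirely of links from U. -/
open Finset

/-- A flow on a directed graph (given by `tail`/`head` maps on links) is a real-valued
function on links satisfying conservation at every node: total flow on links with head `n`
equals total flow on links with tail `n`. -/
def IsFlow {N L : Type} [Fintype L] [DecidableEq N]
    (tail head : L → N) (f : L → ℝ) : Prop :=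
  ∀ n : N, ∑ l ∈ Finset.univ.filter (fun l => head l = n), f l
         = ∑ l ∈ Finset.univ.filter (fun l => tail l = n), f l

/-- A directed graph is strongly connected if for every ordered pair of nodes there is a
directed walk from the first to the second. -/
def StronglyConnected {N L : Type} (tail head : L → N) : Prop :=
  ∀ a b : N, ∃ (k : ℕ) (nodes : Fin (k + 1) → N) (links : Fin k → L),
    nodes 0 = a ∧ nodes (Fin.last k) = b ∧
    ∀ i : Fin k, tail (links i) = nodes i.castSucc ∧ head (links i) = nodes i.succ

/-- `InUndirectedCycle tail head U e`: link `e` lies on an undirected cycle (a closed walk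
with pairwise distinct links, directions ignored) all of whose links belong to `U`. -/
def InUndirectedCycle {N L : Type} (tail head : L → N) (U : Set L) (e : L) : Prop :=
  ∃ (k : ℕ) (links : Fin (k + 1) → L) (dir : Fin (k + 1) → Bool) (nodes : Fin (k + 2) → N),
    Function.Injective links ∧
    (∀ i, links i ∈ U) ∧
    nodes 0 = nodes (Fin.last (k + 1)) ∧
    (∀ i : Fin (k + 1),
      (tail (links i), head (links i)) =
        (if dir i then (nodes i.castSucc, nodes i.succ)
          else (nodes i.succ, nodes i.castSucc))) ∧
    (∃ i, links i = e)

/-- The set `U` of links contains an undirected cycle. -/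
def HasUndirectedCycleIn {N L : Type} (tail head : L → N) (U : Set L) : Prop :=
  ∃ e, InUndirectedCycle tail head U e

/-- Link `e` is identifiable from the measured set `M`: any two nonnegative flows that agree
on every link of `M` agree on `e`. -/
def Identifiable {N L : Type} [Fintype L] [DecidableEq N]
    (tail head : L → N) (M : Set L) (e : L) : Prop :=
  ∀ f g : L → ℝ, IsFlow tail head f → IsFlow tail head g →
    (∀ l, 0 ≤ f l) → (∀ l, 0 ≤ g l) →
    (∀ l ∈ M, f l = g l) → f e = g e

section NetInflow

variable {N L : Type} [Fintype L] [DecidableEq N]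

/-- The boundary map sending a link function to its net inflow at every node. -/
noncomputable def netInflow (tail head : L → N) : (L → ℝ) →ₗ[ℝ] (N → ℝ) :=
  Fintype.linearCombination ℝ fun l => Pi.single (head l) 1 - Pi.single (tail l) 1

theorem netInflow_apply (tail head : L → N) (f : L → ℝ) (n : N) :
    netInflow tail head f n =
      ∑ l, f l * ((if head l = n then 1 else 0) - (if tail l = n then 1 else 0)) := by
  simp [netInflow, Fintype.linearCombination_apply, Finset.sum_apply, Pi.single_apply, eq_comm]

theorem isFlow_iff_netInflow_eq_zero {tail head : L → N} {f : L → ℝ} :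
    IsFlow tail head f ↔ netInflow tail head f = 0 := by
  simp only [IsFlow, funext_iff, netInflow_apply, Pi.zero_apply, mul_sub, mul_ite, mul_one,
    mul_zero, Finset.sum_sub_distrib, ← Finset.sum_filter, sub_eq_zero]

theorem netInflow_single [DecidableEq L] (tail head : L → N) (l : L) (r : ℝ) :
    netInflow tail head (Pi.single l r) =
      r • (Pi.single (head l) 1 - Pi.single (tail l) 1) := by
  rw [netInflow, Fintype.linearCombination_apply_single]

/-- A signed walk carries one unit from its first node to its last node. -/
theorem netInflow_walk [DecidableEq L] (tail head : L → N) {k : ℕ}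
    (links : Fin k → L) (s : Fin k → ℝ) (nodes : Fin (k + 1) → N)
    (h : ∀ i, s i • (Pi.single (head (links i)) 1 - Pi.single (tail (links i)) 1 : N → ℝ) =
      Pi.single (nodes i.succ) 1 - Pi.single (nodes i.castSucc) 1) :
    netInflow tail head (∑ i, Pi.single (links i) (s i)) =
      Pi.single (nodes (Fin.last k)) 1 - Pi.single (nodes 0) 1 := by
  simp only [map_sum, netInflow_single, h, Finset.sum_sub_distrib]
  have h₁ := Fin.sum_univ_succ fun j => (Pi.single (nodes j) 1 : N → ℝ)
  have h₂ := Fin.sum_univ_castSucc fun j => (Pi.single (nodes j) 1 : N → ℝ)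
  rw [sub_eq_sub_iff_add_eq_add, add_comm, ← h₁, h₂, add_comm]

/-- In a strongly connected graph some flow is at least one on every link. -/
theorem StronglyConnected.exists_flow_one_le [DecidableEq L] {tail head : L → N}
    (hsc : StronglyConnected tail head) :
    ∃ f : L → ℝ, IsFlow tail head f ∧ ∀ l, 1 ≤ f l := by
  have key : ∀ l, ∃ f : L → ℝ, netInflow tail head f = 0 ∧ 0 ≤ f ∧ 1 ≤ f l := by
    intro l
    obtain ⟨k, nodes, links, h0, hk, h⟩ := hsc (head l) (tail l)
    have hw : (0 : L → ℝ) ≤ ∑ i, Pi.single (links i) 1 :=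
      Finset.sum_nonneg fun i _ => Pi.single_nonneg.2 zero_le_one
    refine ⟨(∑ i, Pi.single (links i) 1) + Pi.single l 1, ?_,
      add_nonneg hw (Pi.single_nonneg.2 zero_le_one), ?_⟩
    · rw [map_add, netInflow_walk tail head links (fun _ => 1) nodes, netInflow_single, h0, hk]
      · simp
      · intro i
        rw [(h i).1, (h i).2, one_smul]
    · simpa using hw l
  choose f hf hnonneg hone using key
  refine ⟨∑ l, f l, ?_, fun l => ?_⟩
  · simp [isFlow_iff_netInflow_eq_zero, hf]
  · rw [Finset.sum_apply]
    exact (hone l).trans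
      (Finset.single_le_sum (f := fun c => f c l) (fun i _ => hnonneg i l) (Finset.mem_univ l))

/-- A flow which vanishes on every other link across a cut vanishes on the remaining one. -/
theorem IsFlow.eq_zero_of_cut {tail head : L → N} {d : L → ℝ}
    (hd : IsFlow tail head d) [Fintype N] {S : Set N} {e : L}
    (hhead : head e ∈ S) (htail : tail e ∉ S)
    (hcut : ∀ l, l ≠ e → d l ≠ 0 → (head l ∈ S ↔ tail l ∈ S)) : d e = 0 := by
  classical
  have h0 : ∑ n ∈ S.toFinset, netInflow tail head d n = 0 := by
    simp [isFlow_iff_netInflow_eq_zero.1 hd]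
  simp only [netInflow_apply] at h0
  rw [Finset.sum_comm] at h0
  simp only [← Finset.mul_sum, Finset.sum_sub_distrib, Finset.sum_ite_eq, Set.mem_toFinset] at h0
  rw [Finset.sum_eq_single e] at h0
  · simpa [hhead, htail] using h0
  · intro l _ hl
    by_cases hdl : d l = 0
    · simp [hdl]
    · simp [hcut l hl hdl]
  · simp

end NetInflow

section Trail

variable {N L : Type}

/-- Link `l` joins `a` and `b`, in one of the two directions. -/
def Joins (tail head : L → N) (l : L) (a b : N) : Prop :=
  (tail l = a ∧ head l = b) ∨ (tail l = b ∧ head l = a)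

/-- The first `k` terms of `links` form an undirected trail in `U` through the first
`k + 1` terms of `nodes`. -/
structure IsTrail (tail head : L → N) (U : Set L) (k : ℕ) (links : ℕ → L) (nodes : ℕ → N) :
    Prop where
  mem : ∀ i < k, links i ∈ U
  inj : ∀ i < k, ∀ j < k, links i = links j → i = j
  joins : ∀ i < k, Joins tail head (links i) (nodes i) (nodes (i + 1))

variable {tail head : L → N} {U V : Set L} {k : ℕ} {links : ℕ → L} {nodes : ℕ → N}

theorem IsTrail.mono (h : IsTrail tail head U k links nodes) (hUV : U ⊆ V) :
    IsTrail tail head V k links nodes :=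
  ⟨fun i hi => hUV (h.mem i hi), h.inj, h.joins⟩

theorem IsTrail.take (h : IsTrail tail head U k links nodes) {j : ℕ} (hj : j ≤ k) :
    IsTrail tail head U j links nodes :=
  ⟨fun i hi => h.mem i (hi.trans_le hj),
    fun a ha b hb => h.inj a (ha.trans_le hj) b (hb.trans_le hj),
    fun i hi => h.joins i (hi.trans_le hj)⟩

theorem IsTrail.append (h : IsTrail tail head U k links nodes) {l : L} {m : N}
    (hl : l ∈ U) (hnew : ∀ i < k, links i ≠ l) (hm : Joins tail head l (nodes k) m) :
    IsTrail tail head U (k + 1) (Function.update links k l) (Function.update nodes (k + 1) m) := by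
  have old : ∀ i < k, Function.update links k l i = links i := fun i hi =>
    Function.update_of_ne hi.ne _ _
  refine ⟨fun i hi => ?_, fun i hi j hj hij => ?_, fun i hi => ?_⟩
  · rcases Nat.lt_succ_iff_lt_or_eq.1 hi with hi | rfl
    · rw [old i hi]; exact h.mem i hi
    · simpa using hl
  · rcases Nat.lt_succ_iff_lt_or_eq.1 hi with hi | rfl <;>
      rcases Nat.lt_succ_iff_lt_or_eq.1 hj with hj | rfl
    · rw [old i hi, old j hj] at hij
      exact h.inj i hi j hj hij
    · rw [old i hi, Function.update_self] at hij
      exact absurd hij (hnew i hi)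
    · rw [old j hj, Function.update_self] at hij
      exact absurd hij.symm (hnew j hj)
    · rfl
  · rcases Nat.lt_succ_iff_lt_or_eq.1 hi with hi | rfl
    · rw [old i hi, Function.update_of_ne (by omega), Function.update_of_ne (by omega)]
      exact h.joins i hi
    · simpa using hm

/-- Node `b` can be reached from `a` by an undirected trail in `U`. -/
def TrailReachable (tail head : L → N) (U : Set L) (a b : N) : Prop :=
  ∃ k links nodes, IsTrail tail head U k links nodes ∧ nodes 0 = a ∧ nodes k = b

theorem TrailReachable.step {a b c : N} (h : TrailReachable tail head U a b) {l : L}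
    (hl : l ∈ U) (hbc : Joins tail head l b c) : TrailReachable tail head U a c := by
  obtain ⟨k, links, nodes, ht, h0, rfl⟩ := h
  by_cases hused : ∃ i < k, links i = l
  · obtain ⟨i, hi, rfl⟩ := hused
    have hc : nodes i = c ∨ nodes (i + 1) = c := by
      rcases hbc with h₁ | h₁ <;> rcases ht.joins i hi with h₂ | h₂ <;> grind
    rcases hc with hc | hc
    · exact ⟨i, links, nodes, ht.take hi.le, h0, hc⟩
    · exact ⟨i + 1, links, nodes, ht.take hi, h0, hc⟩
  · push Not at hused
    refine ⟨k + 1, _, _, ht.append hl hused hbc, ?_, Function.update_self ..⟩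
    rw [Function.update_of_ne (Nat.succ_ne_zero k).symm, h0]

theorem IsTrail.inUndirectedCycle (h : IsTrail tail head U (k + 1) links nodes)
    (hclosed : nodes 0 = nodes (k + 1)) {i : ℕ} (hi : i < k + 1) :
    InUndirectedCycle tail head U (links i) := by
  classical
  refine ⟨k, fun j => links j, fun j => decide (tail (links j) = nodes j ∧
    head (links j) = nodes (j + 1)), fun j => nodes j, fun a b hab => ?_, fun j => h.mem j j.2,
    ?_, fun j => ?_, ⟨i, hi⟩, rfl⟩
  · exact Fin.ext (h.inj a a.2 b b.2 hab)
  · simpa using hclosed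
  · rcases h.joins j j.2 with hj | hj
    · simp [hj]
    · split_ifs with hd
      · simpa using hd
      · simp [hj]

theorem inUndirectedCycle_of_trailReachable {e : L} (he : e ∈ U)
    (h : TrailReachable tail head (U \ {e}) (head e) (tail e)) :
    InUndirectedCycle tail head U e := by
  obtain ⟨k, links, nodes, ht, h0, hk⟩ := h
  have happ := (ht.mono Set.sdiff_subset).append he (fun i hi => (ht.mem i hi).2)
    (m := head e) (Or.inl ⟨hk.symm, rfl⟩)
  have hcyc := happ.inUndirectedCycle (i := k) (by simp [Function.update_of_ne, h0])
    (Nat.lt_succ_self k)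
  rwa [Function.update_self] at hcyc

end Trail

/-- An undirected cycle through `e` carries a signed unit flow. -/
theorem InUndirectedCycle.exists_flow {N L : Type} [Fintype L] [DecidableEq N] [DecidableEq L]
    {tail head : L → N} {U : Set L} {e : L} (h : InUndirectedCycle tail head U e) :
    ∃ c : L → ℝ, IsFlow tail head c ∧ (∀ l ∉ U, c l = 0) ∧ (∀ l, |c l| ≤ 1) ∧ c e ≠ 0 := by
  obtain ⟨k, links, dir, nodes, hinj, hU, hclosed, hdir, i₀, rfl⟩ := h
  set s : Fin (k + 1) → ℝ := fun i => if dir i then 1 else -1 with hs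
  set c : L → ℝ := ∑ i, Pi.single (links i) (s i) with hc
  have hoff : ∀ l, (∀ i, links i ≠ l) → c l = 0 := by
    intro l hl
    rw [hc, Finset.sum_apply]
    exact Finset.sum_eq_zero fun i _ => Pi.single_eq_of_ne (hl i).symm _
  have hon : ∀ i, c (links i) = s i := by
    intro i
    rw [hc, Finset.sum_apply, Finset.sum_eq_single i]
    · simp
    · exact fun j _ hj => Pi.single_eq_of_ne (hinj.ne hj.symm) _
    · simp
  have habs : ∀ i, |s i| = 1 := by
    intro i
    by_cases hd : dir i <;> simp [hs, hd]
  refine ⟨c, ?_, fun l hl => hoff l fun i hi => hl (hi ▸ hU i), fun l => ?_, ?_⟩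
  · rw [isFlow_iff_netInflow_eq_zero, netInflow_walk tail head links s nodes, hclosed, sub_self]
    intro i
    have hi := hdir i
    by_cases hd : dir i <;> simp only [hd, if_true, if_false, Prod.mk.injEq, Bool.false_eq_true]
      at hi <;> simp [hs, hd, hi.1, hi.2]
  · by_cases hl : ∃ i, links i = l
    · obtain ⟨i, rfl⟩ := hl
      rw [hon, habs]
    · push Not at hl
      simp [hoff l hl]
  · rw [hon, ← abs_pos, habs]
    exact one_pos

/-- In a finite strongly connected directed graph with measured links `M`
and unmeasured links `U = Mᶜ`, an unmeasured link `e` is identifiable from `M` iff `e`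
does not belong to any undirected cycle consisting entirely of unmeasured links. -/
theorem identifiable_iff_not_in_unmeasured_cycle
    {N L : Type} [Fintype N] [Fintype L] [DecidableEq N] [DecidableEq L]
    (tail head : L → N) (hsc : StronglyConnected tail head)
    (M : Set L) (e : L) (he : e ∉ M) :
    Identifiable tail head M e ↔ ¬ InUndirectedCycle tail head Mᶜ e := by
  constructor
  · intro hid hcyc
    obtain ⟨c, hc, hcM, hcle, hce⟩ := hcyc.exists_flow
    obtain ⟨f, hf, hf1⟩ := hsc.exists_flow_one_le
    have hfc : IsFlow tail head (f + c) := by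
      rw [isFlow_iff_netInflow_eq_zero] at *
      rw [map_add, hf, hc, add_zero]
    have heq := hid f (f + c) hf hfc (fun l => zero_le_one.trans (hf1 l))
      (fun l => by
        have := neg_le_of_abs_le (hcle l)
        rw [Pi.add_apply]
        linarith [hf1 l])
      (fun l hl => by simp [hcM l (not_not.2 hl)])
    exact hce (by simpa using heq)
  · intro hcyc f g hf hg _ _ hfg
    have hd : IsFlow tail head (f - g) := by
      rw [isFlow_iff_netInflow_eq_zero] at *
      rw [map_sub, hf, hg, sub_zero]
    refine sub_eq_zero.1 (hd.eq_zero_of_cut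
      (S := {n | TrailReachable tail head (Mᶜ \ {e}) (head e) n}) ?_ ?_ ?_)
    · exact ⟨0, fun _ => e, fun _ => head e, ⟨by simp, by simp, by simp⟩, rfl, rfl⟩
    · exact fun h => hcyc (inUndirectedCycle_of_trailReachable he h)
    · intro l hle hl
      have hlU : l ∈ Mᶜ \ {e} := ⟨fun hM => hl (sub_eq_zero.2 (hfg l hM)), hle⟩
      exact ⟨fun h => TrailReachable.step h hlU (Or.inr ⟨rfl, rfl⟩),
        fun h => TrailReachable.step h hlU (Or.inl ⟨rfl, rfl⟩)⟩
end

section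
/- Let G = (N, L) be a finite directed graph, M ⊆ L, U = L \ M, and let e ∈ U be a link that does not belong to any undirected cycle consisting entirely of links from U. Then any two flows (real-valued, satisfying flow conservation at every node) that agree on every link of M also agree on e. -/
open Finset

/-- The simple graph on the nodes in which two distinct nodes are adjacent when some link
of `U`, in either direction, joins them. -/
def linkGraph {N L : Type} (tail head : L → N) (U : Set L) : SimpleGraph N :=
  SimpleGraph.fromRel fun a b => ∃ l ∈ U, tail l = a ∧ head l = b

theorem linkGraph_reachable_of_mem {N L : Type} {tail head : L → N} {U : Set L} {l : L}
    (hl : l ∈ U) : (linkGraph tail head U).Reachable (tail l) (head l) := by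
  by_cases h : tail l = head l
  · rw [h]
  · exact SimpleGraph.Adj.reachable
      ((SimpleGraph.fromRel_adj _ _ _).2 ⟨h, Or.inl ⟨l, hl, rfl, rfl⟩⟩)

theorem exists_link_of_linkGraph_adj {N L : Type} {tail head : L → N} {U : Set L} {a b : N}
    (h : (linkGraph tail head U).Adj a b) :
    ∃ (l : L) (d : Bool), l ∈ U ∧
      (tail l, head l) = (if d then (a, b) else (b, a)) := by
  obtain ⟨-, ⟨l, hl, ht, hh⟩ | ⟨l, hl, ht, hh⟩⟩ := (SimpleGraph.fromRel_adj _ _ _).1 h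
  · exact ⟨l, true, hl, by simp [ht, hh]⟩
  · exact ⟨l, false, hl, by simp [ht, hh]⟩

/-- A link whose endpoints are joined by a path of other links of `U` lies on an undirected
cycle in `U`. -/
theorem inUndirectedCycle_of_reachable {N L : Type} {tail head : L → N} {U : Set L} {e : L}
    (he : e ∈ U) (h : (linkGraph tail head (U \ {e})).Reachable (head e) (tail e)) :
    InUndirectedCycle tail head U e := by
  classical
  obtain ⟨p, hp⟩ := h.exists_isPath
  have hstep (i : Fin p.length) := exists_link_of_linkGraph_adj (p.adj_getVert_succ i.2)
  choose links dir hU hends using hstep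
  have hinj : Function.Injective links := by
    intro i j hij
    have hi := hends i
    have hj := hends j
    rw [hij, hj] at hi
    have inj {a b : ℕ} (ha : a ≤ p.length) (hb : b ≤ p.length)
        (hab : p.getVert a = p.getVert b) : a = b := hp.getVert_injOn ha hb hab
    have key : (p.getVert i = p.getVert j) ∨
        (p.getVert i = p.getVert (j + 1) ∧ p.getVert (i + 1) = p.getVert j) := by
      split_ifs at hi <;> simp only [Prod.mk.injEq] at hi <;> grind
    rcases key with h | ⟨h₁, h₂⟩
    · exact Fin.ext (inj i.2.le j.2.le h)
    · have := inj i.2.le j.2 h₁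
      have := inj i.2 j.2.le h₂
      omega
  refine ⟨p.length, Fin.cons e links, Fin.cons true dir,
    Fin.cons (tail e) fun i : Fin (p.length + 1) => p.getVert i, ?_, ?_, ?_, ?_, 0, rfl⟩
  · refine Fin.cons_injective_iff.2 ⟨?_, hinj⟩
    rintro ⟨i, hi⟩
    exact (hU i).2 hi
  · exact Fin.cases he fun i => (hU i).1
  · rw [← Fin.succ_last]
    simp
  · refine Fin.cases ?_ fun i => ?_
    · simp
    · rw [← Fin.succ_castSucc]
      simpa using hends i

/-- The total flow into a set of nodes equals the total flow out of it. -/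
theorem IsFlow.sum_head_mem_eq_sum_tail_mem {N L : Type} [Fintype L] [DecidableEq N]
    {tail head : L → N} {f : L → ℝ} (hf : IsFlow tail head f) (S : Finset N) :
    ∑ l, (if head l ∈ S then f l else 0) = ∑ l, (if tail l ∈ S then f l else 0) := by
  have h := Finset.sum_congr (rfl : S = S) fun n _ => hf n
  simp only [Finset.sum_filter] at h
  rw [Finset.sum_comm, Finset.sum_comm (s := S)] at h
  simpa only [Finset.sum_ite_eq] using h

theorem IsFlow.sub {N L : Type} [Fintype L] [DecidableEq N]
    {tail head : L → N} {f g : L → ℝ} (hf : IsFlow tail head f) (hg : IsFlow tail head g) :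
    IsFlow tail head (f - g) := fun n => by
  simp only [Pi.sub_apply, Finset.sum_sub_distrib, hf n, hg n]

/-- **sufficiency.** If an unmeasured link `e` does not belong to any
undirected cycle of unmeasured links, then any two flows agreeing on all measured links
agree on `e`. -/
theorem flows_agree_of_not_in_unmeasured_cycle
    {N L : Type} [Fintype N] [Fintype L] [DecidableEq N] [DecidableEq L]
    (tail head : L → N) (M : Set L) (e : L) (he : e ∉ M)
    (hcyc : ¬ InUndirectedCycle tail head Mᶜ e)
    (f g : L → ℝ) (hf : IsFlow tail head f) (hg : IsFlow tail head g)
    (hagree : ∀ l ∈ M, f l = g l) :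
    f e = g e := by
  classical
  set G := linkGraph tail head (Mᶜ \ {e})
  let S : Finset N := Finset.univ.filter fun n => G.Reachable (head e) n
  have hhead : head e ∈ S := by simp [S]
  have htail : tail e ∉ S := fun h =>
    hcyc (inUndirectedCycle_of_reachable he (Finset.mem_filter.1 h).2)
  have hcut := (hf.sub hg).sum_head_mem_eq_sum_tail_mem S
  rw [← sub_eq_zero, ← Finset.sum_sub_distrib, Finset.sum_eq_single e] at hcut
  · simpa [hhead, htail, sub_eq_zero] using hcut
  · intro l _ hle
    by_cases hl : l ∈ M
    · simp [hagree l hl]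
    · have hr : G.Reachable (tail l) (head l) := linkGraph_reachable_of_mem ⟨hl, hle⟩
      have hiff : head l ∈ S ↔ tail l ∈ S := by
        simp only [S, Finset.mem_filter_univ]
        exact ⟨fun h => h.trans hr.symm, fun h => h.trans hr⟩
      simp [hiff]
  · simp
end

section
/- Let G = (N, L) be a finite strongly connected directed graph, M ⊆ L, U = L \ M, and suppose U contains a directed cycle with link set C. Then for every nonnegative flow f⁰ with strictly positive value on every link and every K > 0, there exists a nonnegative flow g that agrees with f⁰ on every link of M and satisfies g(l) > K for every link l ∈ C. In particular the unmeasured flows consistent with the measurements can be arbitrarily large. -/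
open Finset

/-- `IsDirectedCycleSet tail head C`: the set `C` is exactly the link set of a directed
cycle, i.e. a closed walk with pairwise distinct links all oriented consistently. -/
def IsDirectedCycleSet {N L : Type} (tail head : L → N) (C : Set L) : Prop :=
  ∃ (k : ℕ) (links : Fin (k + 1) → L) (nodes : Fin (k + 2) → N),
    Function.Injective links ∧
    Set.range links = C ∧
    nodes 0 = nodes (Fin.last (k + 1)) ∧
    ∀ i : Fin (k + 1), tail (links i) = nodes i.castSucc ∧ head (links i) = nodes i.succ

/-- The set `U` of links contains a directed cycle. -/
def HasDirectedCycleIn {N L : Type} (tail head : L → N) (U : Set L) : Prop :=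
  ∃ C : Set L, C ⊆ U ∧ IsDirectedCycleSet tail head C

/-- The number of times a sequence of links traverses each link, as a real number. -/
def traversalCount {L : Type} [DecidableEq L] {m : ℕ} (links : Fin m → L) (l : L) : ℝ :=
  ∑ i, if links i = l then 1 else 0

lemma traversalCount_nonneg {L : Type} [DecidableEq L] {m : ℕ} (links : Fin m → L) (l : L) :
    0 ≤ traversalCount links l :=
  Finset.sum_nonneg fun i _ => by split_ifs <;> norm_num

lemma one_le_traversalCount {L : Type} [DecidableEq L] {m : ℕ} (links : Fin m → L) (i : Fin m) :
    1 ≤ traversalCount links (links i) := by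
  have h := Finset.single_le_sum (f := fun j => if links j = links i then (1 : ℝ) else 0)
    (fun j _ => by split_ifs <;> norm_num) (Finset.mem_univ i)
  simpa [traversalCount] using h

lemma traversalCount_eq_zero {L : Type} [DecidableEq L] {m : ℕ} (links : Fin m → L) {l : L}
    (hl : l ∉ Set.range links) : traversalCount links l = 0 :=
  Finset.sum_eq_zero fun i _ => if_neg fun h => hl ⟨i, h⟩

lemma sum_filter_traversalCount {L : Type} [Fintype L] [DecidableEq L] {m : ℕ}
    (links : Fin m → L) (p : L → Prop) [DecidablePred p] :
    ∑ l ∈ Finset.univ.filter p, traversalCount links l = ∑ i, if p (links i) then 1 else 0 := by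
  simp only [traversalCount]
  rw [Finset.sum_comm]
  simp

/-- The traversal count of a closed directed walk is a flow. -/
lemma isFlow_traversalCount {N L : Type} [Fintype L] [DecidableEq N] [DecidableEq L]
    {tail head : L → N} {m : ℕ} {links : Fin m → L} {nodes : Fin (m + 1) → N}
    (hclosed : nodes 0 = nodes (Fin.last m))
    (hwalk : ∀ i, tail (links i) = nodes i.castSucc ∧ head (links i) = nodes i.succ) :
    IsFlow tail head (traversalCount links) := by
  intro n
  simp only [sum_filter_traversalCount, hwalk]
  have h := (Fin.sum_univ_succ fun i => if nodes i = n then (1 : ℝ) else 0).symm.trans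
    (Fin.sum_univ_castSucc _)
  rw [hclosed] at h
  linarith

lemma IsFlow.add_mul {N L : Type} [Fintype L] [DecidableEq N] {tail head : L → N}
    {f g : L → ℝ} (hf : IsFlow tail head f) (hg : IsFlow tail head g) (c : ℝ) :
    IsFlow tail head fun l => f l + c * g l := by
  intro n
  simp only [Finset.sum_add_distrib, ← Finset.mul_sum, hf n, hg n]

/-- If the unmeasured links contain a directed cycle with link set `C`,
then for every everywhere-positive flow `f0` and every `K > 0` there is a nonnegative flow
`g` that agrees with `f0` on all measured links and exceeds `K` on every link of `C`:
the unmeasured flows consistent with the measurements can be arbitrarily large. -/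
theorem unmeasured_directed_cycle_flows_unbounded
    {N L : Type} [Fintype N] [Fintype L] [DecidableEq N] [DecidableEq L]
    (tail head : L → N) (hsc : StronglyConnected tail head)
    (M : Set L) (C : Set L) (hCU : C ⊆ Mᶜ)
    (hC : IsDirectedCycleSet tail head C)
    (f0 : L → ℝ) (hf0 : IsFlow tail head f0) (hf0pos : ∀ l, 0 < f0 l)
    (K : ℝ) (hK : 0 < K) :
    ∃ g : L → ℝ, IsFlow tail head g ∧ (∀ l, 0 ≤ g l) ∧
      (∀ l ∈ M, g l = f0 l) ∧ ∀ l ∈ C, K < g l := by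
  obtain ⟨k, links, nodes, -, rfl, hclosed, hwalk⟩ := hC
  refine ⟨fun l => f0 l + K * traversalCount links l,
    hf0.add_mul (isFlow_traversalCount hclosed hwalk) K, fun l => ?_, fun l hl => ?_, ?_⟩
  · exact add_nonneg (hf0pos l).le (mul_nonneg hK.le (traversalCount_nonneg links l))
  · simp [traversalCount_eq_zero links fun h => hCU h hl]
  · rintro _ ⟨i, rfl⟩
    nlinarith [hf0pos (links i), one_le_traversalCount links i]
end

section
/- Let G = (N, L) be a finite directed graph, M ⊆ L, U = L \ M, and suppose U contains no directed cycle. Then for every assignment of measured values m : M → ℝ there exists a constant B (depending only on G and on m) such that every nonnegative flow f agreeing with m on M satisfies f(l) ≤ B for every l ∈ U; i.e., the set of nonnegative flows consistent with the measurements is bounded on the unmeasured links. -/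
open Finset

/-- An infinite directed walk in a finite graph closes up to a directed cycle. -/
theorem hasDirectedCycleIn_of_infinite_walk {N L : Type} [Finite L] {tail head : L → N}
    {U : Set L} (g : ℕ → L) (hU : ∀ n, g n ∈ U) (hg : ∀ n, tail (g (n + 1)) = head (g n)) :
    HasDirectedCycleIn tail head U := by
  classical
  have hex : ∃ k i, g (i + (k + 1)) = g i := by
    obtain ⟨a, b, hab, h⟩ := Finite.exists_ne_map_eq_of_infinite g
    rcases lt_or_gt_of_ne hab with hlt | hlt
    · exact ⟨b - a - 1, a, by rw [show a + (b - a - 1 + 1) = b by omega, h]⟩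
    · exact ⟨a - b - 1, b, by rw [show b + (a - b - 1 + 1) = a by omega, h]⟩
  obtain ⟨i, hi⟩ := Nat.find_spec hex
  have hmin : ∀ a b, a < b → b < Nat.find hex + 1 → g (i + a) ≠ g (i + b) := by
    intro a b hab hb h
    refine Nat.find_min hex (m := b - a - 1) (by omega) ⟨i + a, ?_⟩
    rw [show i + a + (b - a - 1 + 1) = i + b by omega, h]
  refine ⟨Set.range fun j : Fin (Nat.find hex + 1) => g (i + j), ?_,
    Nat.find hex, _, fun j => tail (g (i + j)), ?_, rfl, ?_, ?_⟩
  · rintro _ ⟨j, rfl⟩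
    exact hU _
  · intro a b h
    rcases lt_trichotomy a b with hab | hab | hab
    · exact absurd h (hmin a b hab b.isLt)
    · exact hab
    · exact absurd h.symm (hmin b a hab a.isLt)
  · simp [hi]
  · intro j
    exact ⟨rfl, (hg (i + j)).symm⟩

/-- In a finite graph, succession along links of an acyclic set is well founded. -/
theorem wellFounded_of_not_hasDirectedCycleIn {N L : Type} [Finite L] {tail head : L → N}
    {U : Set L} (h : ¬ HasDirectedCycleIn tail head U) :
    WellFounded fun a b : L => a ∈ U ∧ tail a = head b := by
  rw [wellFounded_iff_isEmpty_descending_chain]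
  refine ⟨fun ⟨g, hg⟩ => h ?_⟩
  exact hasDirectedCycleIn_of_infinite_walk (fun n => g (n + 1)) (fun n => (hg n).1)
    fun n => (hg (n + 1)).2

/-- A link of a nonnegative flow carries at most the total outflow at its head. -/
theorem IsFlow.le_sum_tail_eq_head {N L : Type} [Fintype L] [DecidableEq N]
    {tail head : L → N} {f : L → ℝ} (hf : IsFlow tail head f) (hf0 : ∀ l, 0 ≤ f l) (l : L) :
    f l ≤ ∑ l' ∈ Finset.univ.filter (fun l' => tail l' = head l), f l' := by
  rw [← hf (head l)]
  exact Finset.single_le_sum (fun l' _ => hf0 l') (by simp)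

/-- If the unmeasured links contain no directed cycle, then for every
assignment `m` of measured values there is a bound `B` such that every nonnegative flow
agreeing with `m` on the measured links is at most `B` on every unmeasured link. -/
theorem unmeasured_flows_bounded_of_no_directed_cycle
    {N L : Type} [Fintype N] [Fintype L] [DecidableEq N] [DecidableEq L]
    (tail head : L → N) (M : Set L)
    (hnc : ¬ HasDirectedCycleIn tail head Mᶜ)
    (m : L → ℝ) :
    ∃ B : ℝ, ∀ f : L → ℝ, IsFlow tail head f → (∀ l, 0 ≤ f l) →
      (∀ l ∈ M, f l = m l) → ∀ l ∈ Mᶜ, f l ≤ B := by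
  have hbound : ∀ l, ∃ B : ℝ, ∀ f : L → ℝ, IsFlow tail head f → (∀ l, 0 ≤ f l) →
      (∀ l ∈ M, f l = m l) → f l ≤ B := by
    intro l
    induction l using (wellFounded_of_not_hasDirectedCycleIn hnc).induction with
    | _ l ih =>
      have hsucc : ∀ l', ∃ B : ℝ, tail l' = head l → ∀ f : L → ℝ, IsFlow tail head f →
          (∀ l, 0 ≤ f l) → (∀ l ∈ M, f l = m l) → f l' ≤ B := by
        intro l'
        by_cases hM : l' ∈ M
        · exact ⟨m l', fun _ f _ _ hm => (hm l' hM).le⟩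
        · by_cases hl : tail l' = head l
          · obtain ⟨B, hB⟩ := ih l' ⟨hM, hl⟩
            exact ⟨B, fun _ => hB⟩
          · exact ⟨0, fun h => absurd h hl⟩
      choose B hB using hsucc
      refine ⟨∑ l' ∈ Finset.univ.filter (fun l' => tail l' = head l), B l',
        fun f hf hf0 hm => (hf.le_sum_tail_eq_head hf0 l).trans ?_⟩
      exact Finset.sum_le_sum fun l' hl' => hB l' (by simpa using hl') f hf hf0 hm
  choose B hB using hbound
  obtain ⟨C, hC⟩ := Finite.bddAbove_range B
  exact ⟨C, fun f hf hf0 hm l _ => (hB l f hf hf0 hm).trans (hC ⟨l, rfl⟩)⟩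
end
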